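/- Let K ∈ ℕ, let v₁, …, v_K ∈ ℝ³ be vectors with ‖v_k‖ ≥ d for some d > 0, let F be the 3K×K real block-diagonal matrix whose k-th column has the block v_k in rows 3k−2, 3k−1, 3k and zeros elsewhere, and let A be a real symmetric positive definite 3K×3K matrix. Then for every z ∈ ℝ^K, zᵀ(FᵀAF)z ≥ d²·λ_min(A)·‖z‖²; in particular FᵀAF is symmetric positive definite. -/

import Mathlib

open Matrix

/-- Rayleigh bound: the smallest eigenvalue bounds the quadratic form of a real symmetric matrix
from below. -/
theorem Matrix.IsHermitian.iInf_eigenvalues_mul_dotProduct_le {n : Type*} [Fintype n]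
    [DecidableEq n] {A : Matrix n n ℝ} (hA : A.IsHermitian) (x : n → ℝ) :
    (⨅ p, hA.eigenvalues p) * (x ⬝ᵥ x) ≤ x ⬝ᵥ A *ᵥ x := by
  set U : Matrix n n ℝ := (hA.eigenvectorUnitary).1
  have hspec : A = U * diagonal hA.eigenvalues * Uᵀ := by
    have h := hA.spectral_theorem
    rw [Unitary.conjStarAlgAut_apply] at h
    exact h
  have hUU : U * Uᵀ = 1 := Unitary.coe_mul_star_self hA.eigenvectorUnitary
  have hform (M : Matrix n n ℝ) : x ⬝ᵥ (U * M * Uᵀ) *ᵥ x = (Uᵀ *ᵥ x) ⬝ᵥ M *ᵥ (Uᵀ *ᵥ x) := by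
    rw [← mulVec_mulVec, ← mulVec_mulVec, dotProduct_mulVec, ← mulVec_transpose]
  have hquad : x ⬝ᵥ A *ᵥ x = ∑ i, hA.eigenvalues i * ((Uᵀ *ᵥ x) i * (Uᵀ *ᵥ x) i) := by
    conv_lhs => rw [hspec]
    rw [hform, dotProduct]
    refine Finset.sum_congr rfl fun i _ => ?_
    rw [mulVec_diagonal]
    ring
  have hnorm : x ⬝ᵥ x = ∑ i, (Uᵀ *ᵥ x) i * (Uᵀ *ᵥ x) i := by
    have h := hform 1
    rwa [mul_one, hUU, one_mulVec, one_mulVec] at h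
  rw [hquad, hnorm, Finset.mul_sum]
  gcongr with i
  · exact mul_self_nonneg _
  · exact ciInf_le (Set.finite_range _).bddBelow i

/-- Positive definiteness of `Fᵀ A F` for the block-diagonal matrix `F` built from
vectors `v_k ∈ ℝ³` with `‖v_k‖ ≥ d > 0` and a symmetric positive definite `A`:
for all `z ∈ ℝ^K`, `zᵀ (Fᵀ A F) z ≥ d² λ_min(A) ‖z‖²`, and `Fᵀ A F` is positive
definite. Rows of `F` are indexed by `Fin K × Fin 3` (the `k`-th column carries the
block `v_k` in the rows `(k, ·)`). -/
theorem stmt_17 (K : ℕ) (d : ℝ) (hd : 0 < d) (v : Fin K → Fin 3 → ℝ)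
    (hv : ∀ k, Real.sqrt (∑ i, (v k i) ^ 2) ≥ d)
    (F : Matrix (Fin K × Fin 3) (Fin K) ℝ)
    (hF : ∀ p j, F p j = if p.1 = j then v j p.2 else 0)
    (A : Matrix (Fin K × Fin 3) (Fin K × Fin 3) ℝ) (hA : A.PosDef) :
    (∀ z : Fin K → ℝ,
      z ⬝ᵥ (Fᵀ * A * F).mulVec z ≥ d ^ 2 * (⨅ p, hA.1.eigenvalues p) * ∑ j, (z j) ^ 2) ∧
    (Fᵀ * A * F).PosDef := by
  have hFz (z : Fin K → ℝ) (p : Fin K × Fin 3) : (F *ᵥ z) p = v p.1 p.2 * z p.1 := by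
    simp [mulVec, dotProduct, hF]
  have hv' (k : Fin K) : d ^ 2 ≤ ∑ i, (v k i) ^ 2 := (Real.le_sqrt' hd).1 (hv k)
  have hnorm (z : Fin K → ℝ) : d ^ 2 * ∑ j, (z j) ^ 2 ≤ (F *ᵥ z) ⬝ᵥ (F *ᵥ z) := by
    rw [dotProduct, Fintype.sum_prod_type, Finset.mul_sum]
    refine Finset.sum_le_sum fun k _ => ?_
    calc d ^ 2 * z k ^ 2 ≤ (∑ i, (v k i) ^ 2) * z k ^ 2 := by gcongr; exact hv' k
      _ = ∑ i, (F *ᵥ z) (k, i) * (F *ᵥ z) (k, i) := by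
        rw [Finset.sum_mul]
        refine Finset.sum_congr rfl fun i _ => ?_
        rw [hFz]
        ring
  refine ⟨fun z => ?_, ?_⟩
  · have hmin : 0 ≤ ⨅ p, hA.1.eigenvalues p :=
      Real.iInf_nonneg fun p => hA.posSemidef.eigenvalues_nonneg p
    calc z ⬝ᵥ (Fᵀ * A * F) *ᵥ z = (F *ᵥ z) ⬝ᵥ A *ᵥ (F *ᵥ z) := by
          rw [← mulVec_mulVec, ← mulVec_mulVec, dotProduct_mulVec, ← mulVec_transpose,
            transpose_transpose]
      _ ≥ (⨅ p, hA.1.eigenvalues p) * ((F *ᵥ z) ⬝ᵥ (F *ᵥ z)) :=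
          hA.1.iInf_eigenvalues_mul_dotProduct_le _
      _ ≥ (⨅ p, hA.1.eigenvalues p) * (d ^ 2 * ∑ j, (z j) ^ 2) :=
          mul_le_mul_of_nonneg_left (hnorm z) hmin
      _ = d ^ 2 * (⨅ p, hA.1.eigenvalues p) * ∑ j, (z j) ^ 2 := by ring
  · have hinj : Function.Injective F.mulVec := by
      refine (injective_iff_map_eq_zero F.mulVecLin).2 fun z hz => ?_
      have hz' : F *ᵥ z = 0 := hz
      have hle := hnorm z
      rw [hz', zero_dotProduct] at hle
      have hsum : ∑ j, (z j) ^ 2 = 0 :=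
        le_antisymm (nonpos_of_mul_nonpos_right hle (by positivity)) (by positivity)
      ext j
      have hj := (Finset.sum_eq_zero_iff_of_nonneg fun j _ => sq_nonneg (z j)).1 hsum j
        (Finset.mem_univ j)
      simpa using hj
    simpa using hA.conjTranspose_mul_mul_same hinj
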